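/- Under the hypotheses of the weighted gradient estimate (Φ(x) = x²/2 + Ψ(x) with |∂^α∇Ψ| ≤ C_α, and M⁻¹(Hess Φ)M ≥ δ₀ ∈ (0,1) for all admissible exponential weight matrices M), taking g = x_i and h = x_j for distinct sites i, j ∈ Λ, the two-point correlation function satisfies |cor(i,j)| = |cov(x_i, x_j)| ≤ C e^{−κ d(i,j)}, with C, κ > 0 independent of Λ. -/

import Mathlib

noncomputable section
open MeasureTheory Real Filter

/-- Partial derivative of `u` in the `i`-th coordinate direction. -/
def pd {Λ : Type*} [Fintype Λ] [DecidableEq Λ] (u : EuclideanSpace ℝ Λ → ℝ)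
    (i : Λ) (x : EuclideanSpace ℝ Λ) : ℝ :=
  fderiv ℝ u x (EuclideanSpace.single i 1)

/-- Laplacian of `u` (sum of second partial derivatives). -/
def lap {Λ : Type*} [Fintype Λ] [DecidableEq Λ] (u : EuclideanSpace ℝ Λ → ℝ)
    (x : EuclideanSpace ℝ Λ) : ℝ :=
  ∑ i, pd (pd u i) i x

/-- Hessian entry `∂_i ∂_j u (x)`. -/
def hess {Λ : Type*} [Fintype Λ] [DecidableEq Λ] (u : EuclideanSpace ℝ Λ → ℝ)
    (x : EuclideanSpace ℝ Λ) (i j : Λ) : ℝ :=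
  pd (pd u j) i x

/-- The normalized Gibbs measure `Z⁻¹ e^{-Φ} dx`. -/
def gibbs {Λ : Type*} [Fintype Λ] (Φ : EuclideanSpace ℝ Λ → ℝ) :
    Measure (EuclideanSpace ℝ Λ) :=
  (ENNReal.ofReal (∫ x, Real.exp (-Φ x)))⁻¹ •
    ((volume : Measure (EuclideanSpace ℝ Λ)).withDensity
      fun x => ENNReal.ofReal (Real.exp (-Φ x)))

/-- The ℓ¹ (lattice) distance between two sites of `ℤ^d`. -/
def latDist {d : ℕ} (i j : Fin d → ℤ) : ℕ := ∑ k, (i k - j k).natAbs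

/-- The lattice distance from a site to a finite set of sites. -/
def latDistSet {d : ℕ} (i : Fin d → ℤ) (S : Finset (Fin d → ℤ)) : ℝ :=
  sInf ((fun j => (latDist i j : ℝ)) '' ↑S)

/-- The lattice distance between two finite sets of sites. -/
def latDistSets {d : ℕ} (S T : Finset (Fin d → ℤ)) : ℝ :=
  sInf (Set.image2 (fun i j => (latDist i j : ℝ)) (↑S : Set (Fin d → ℤ)) (↑T : Set (Fin d → ℤ)))

section Langevin

variable {E : Type*} [NormedAddCommGroup E]

lemma continuous_of_norm_sub_le {V : Type*} [NormedAddCommGroup V] {b : E → V} {L : ℝ}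
    (hb : ∀ x y, ‖b x - b y‖ ≤ L * ‖x - y‖) : Continuous b :=
  (LipschitzWith.of_dist_le' (by simpa only [dist_eq_norm] using hb)).continuous

/-- Continuous functions of at most polynomial growth. -/
def HasPolyGrowth (F : E → ℝ) : Prop :=
  Continuous F ∧ ∃ K : ℝ, ∃ p : ℕ, ∀ x, |F x| ≤ K * (1 + ‖x‖) ^ p

namespace HasPolyGrowth

variable {F G : E → ℝ}

lemma exists_nonneg (hF : HasPolyGrowth F) :
    ∃ K : ℝ, ∃ p : ℕ, 0 ≤ K ∧ ∀ x, |F x| ≤ K * (1 + ‖x‖) ^ p := by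
  obtain ⟨-, K, p, h⟩ := hF
  refine ⟨|K|, p, abs_nonneg _, fun x => (h x).trans ?_⟩
  gcongr
  exact le_abs_self K

lemma const (c : ℝ) : HasPolyGrowth (fun _ : E => c) :=
  ⟨continuous_const, |c|, 0, fun x => by simp⟩

lemma norm : HasPolyGrowth (fun x : E => ‖x‖) :=
  ⟨continuous_norm, 1, 1, fun x => by simp⟩

lemma add (hF : HasPolyGrowth F) (hG : HasPolyGrowth G) :
    HasPolyGrowth (fun x => F x + G x) := by
  obtain ⟨K, p, hK, h⟩ := hF.exists_nonneg
  obtain ⟨K', p', hK', h'⟩ := hG.exists_nonneg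
  refine ⟨hF.1.add hG.1, K + K', p + p', fun x => ?_⟩
  have h1 : (1 : ℝ) ≤ 1 + ‖x‖ := by simp
  calc |F x + G x| ≤ |F x| + |G x| := abs_add_le _ _
    _ ≤ K * (1 + ‖x‖) ^ p + K' * (1 + ‖x‖) ^ p' := add_le_add (h x) (h' x)
    _ ≤ K * (1 + ‖x‖) ^ (p + p') + K' * (1 + ‖x‖) ^ (p + p') := by
        gcongr <;> first | exact h1 | omega
    _ = _ := by ring

lemma mul (hF : HasPolyGrowth F) (hG : HasPolyGrowth G) :
    HasPolyGrowth (fun x => F x * G x) := by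
  obtain ⟨K, p, hK, h⟩ := hF.exists_nonneg
  obtain ⟨K', p', hK', h'⟩ := hG.exists_nonneg
  refine ⟨hF.1.mul hG.1, K * K', p + p', fun x => ?_⟩
  rw [abs_mul, pow_add, mul_mul_mul_comm]
  exact mul_le_mul (h x) (h' x) (abs_nonneg _) (by positivity)

lemma pow (hF : HasPolyGrowth F) (p : ℕ) : HasPolyGrowth (fun x => F x ^ p) := by
  induction p with
  | zero => simpa using const (E := E) 1
  | succ p ih => simpa only [pow_succ] using ih.mul hF

lemma neg (hF : HasPolyGrowth F) : HasPolyGrowth (fun x => -F x) := by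
  simpa using (const (E := E) (-1)).mul hF

lemma sub (hF : HasPolyGrowth F) (hG : HasPolyGrowth G) :
    HasPolyGrowth (fun x => F x - G x) := by
  simpa [sub_eq_add_neg] using hF.add hG.neg

lemma abs (hF : HasPolyGrowth F) : HasPolyGrowth (fun x => |F x|) :=
  ⟨hF.1.abs, by simpa using hF.2⟩

lemma sum {ι : Type*} (s : Finset ι) {F : ι → E → ℝ} (hF : ∀ l, HasPolyGrowth (F l)) :
    HasPolyGrowth (fun x => ∑ l ∈ s, F l x) := by
  classical
  induction s using Finset.induction_on with
  | empty => simpa using const (E := E) 0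
  | insert a s ha ih => simpa [Finset.sum_insert ha] using (hF a).add ih

lemma mono (hF : Continuous F) (hG : HasPolyGrowth G) (h : ∀ x, |F x| ≤ G x) :
    HasPolyGrowth F := by
  obtain ⟨-, K, p, hK⟩ := hG
  exact ⟨hF, K, p, fun x => (h x).trans ((le_abs_self _).trans (hK x))⟩

lemma norm_of_lipschitz {V : Type*} [NormedAddCommGroup V] {b : E → V} {L : ℝ}
    (hb : ∀ x y, ‖b x - b y‖ ≤ L * ‖x - y‖) :
    HasPolyGrowth (fun x => ‖b x‖) := by
  have hc := continuous_of_norm_sub_le hb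
  refine mono hc.norm ((const ‖b 0‖).add ((const L).mul norm)) fun x => ?_
  have h1 := hb x 0
  have h2 := norm_le_norm_add_norm_sub' (b x) (b 0)
  simp only [abs_norm, sub_zero] at *
  linarith

lemma integrable_mul [MeasurableSpace E] [BorelSpace E] [SecondCountableTopology E]
    {ν : Measure E} {w : E → ℝ} (hw : Continuous w) (hw0 : ∀ x, 0 ≤ w x)
    (hmom : ∀ p : ℕ, Integrable (fun x => (1 + ‖x‖) ^ p * w x) ν) (hF : HasPolyGrowth F) :
    Integrable (fun x => F x * w x) ν := by
  obtain ⟨hc, K, p, hK⟩ := hF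
  refine ((hmom p).const_mul K).mono' (hc.mul hw).aestronglyMeasurable (ae_of_all _ fun x => ?_)
  rw [Real.norm_eq_abs, abs_mul, abs_of_nonneg (hw0 x), ← mul_assoc]
  exact mul_le_mul_of_nonneg_right (hK x) (hw0 x)

end HasPolyGrowth

variable [NormedSpace ℝ E]

/-- `f` is differentiable with derivative `f'`, which is bounded by `L` and `s`-Lipschitz. -/
structure IsC11 (f : E → ℝ) (f' : E → E →L[ℝ] ℝ) (L s : ℝ) : Prop where
  hasFDerivAt : ∀ x, HasFDerivAt f (f' x) x
  norm_le : ∀ x, ‖f' x‖ ≤ L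
  lipschitz : ∀ x y, ‖f' x - f' y‖ ≤ s * ‖x - y‖

namespace IsC11

variable {f : E → ℝ} {f' : E → E →L[ℝ] ℝ} {L s : ℝ}

lemma L_nonneg (hf : IsC11 f f' L s) : 0 ≤ L := (norm_nonneg _).trans (hf.norm_le 0)

lemma continuous (hf : IsC11 f f' L s) : Continuous f :=
  continuous_iff_continuousAt.2 fun x => (hf.hasFDerivAt x).continuousAt

lemma continuous_deriv (hf : IsC11 f f' L s) : Continuous f' :=
  continuous_of_norm_sub_le hf.lipschitz

lemma abs_sub_le (hf : IsC11 f f' L s) (x y : E) : |f x - f y| ≤ L * ‖x - y‖ := by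
  simpa using convex_univ.norm_image_sub_le_of_norm_hasFDerivWithin_le
    (fun z _ => (hf.hasFDerivAt z).hasFDerivWithinAt) (fun z _ => hf.norm_le z)
    (Set.mem_univ y) (Set.mem_univ x)

lemma taylor (hf : IsC11 f f' L s) (hs : 0 ≤ s) (x u : E) :
    |f (x + u) - f x - f' x u| ≤ s * ‖u‖ ^ 2 := by
  have := (convex_segment x (x + u)).norm_image_sub_le_of_norm_hasFDerivWithin_le'
    (f := f) (f' := f') (φ := f' x) (C := s * ‖u‖)
    (fun z _ => (hf.hasFDerivAt z).hasFDerivWithinAt) (fun z hz => ?_)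
    (left_mem_segment ℝ _ _) (right_mem_segment ℝ _ _)
  · simpa [pow_two, mul_assoc] using this
  · refine (hf.lipschitz z x).trans ?_
    gcongr
    simpa using norm_sub_le_of_mem_segment hz

lemma hasPolyGrowth (hf : IsC11 f f' L s) : HasPolyGrowth f := by
  refine HasPolyGrowth.mono hf.continuous (HasPolyGrowth.norm_of_lipschitz (b := f) (L := L)
    (fun x y => by simpa using hf.abs_sub_le x y)) fun x => by simp

lemma hasPolyGrowth_deriv (hf : IsC11 f f' L s) {V : E → E} (hc : Continuous V)
    (hV : HasPolyGrowth (fun x => ‖V x‖)) : HasPolyGrowth (fun x => f' x (V x)) := by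
  refine HasPolyGrowth.mono (hf.continuous_deriv.clm_apply hc)
    ((HasPolyGrowth.const L).mul hV) fun x => ?_
  exact ((f' x).le_opNorm _).trans (by gcongr; exact hf.norm_le x)

lemma hasPolyGrowth_comp (hf : IsC11 f f' L s) {V : E → E} (hc : Continuous V)
    (hV : HasPolyGrowth (fun x => ‖V x‖)) : HasPolyGrowth (fun x => f (V x)) := by
  refine HasPolyGrowth.mono (hf.continuous.comp hc)
    ((HasPolyGrowth.const |f 0|).add ((HasPolyGrowth.const L).mul hV)) fun x => ?_
  have h1 := hf.abs_sub_le (V x) 0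
  have h2 := abs_sub_abs_le_abs_sub (f (V x)) (f 0)
  rw [sub_zero] at h1
  linarith

lemma hasPolyGrowth_shift (hf : IsC11 f f' L s) (u : E) :
    HasPolyGrowth (fun x => f (x + u)) := by
  refine hf.hasPolyGrowth_comp (by fun_prop) ?_
  exact HasPolyGrowth.mono (by fun_prop) (HasPolyGrowth.norm.add (HasPolyGrowth.const ‖u‖))
    fun x => by simpa using norm_add_le x u

end IsC11

/-- An antiderivative in the direction `v` of the second difference
`f (x + h v) + f (x - h v) - 2 f x`. -/
def secondDiffPrimitive (f : E → ℝ) (v : E) (h : ℝ) (x : E) : ℝ :=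
  (∫ t in (0 : ℝ)..h, f (x + t • v)) + ∫ t in (0 : ℝ)..(-h), f (x + t • v)

lemma hasLineDerivAt_secondDiffPrimitive {f : E → ℝ} (hf : Continuous f) (v : E) (h : ℝ) (x : E) :
    HasLineDerivAt ℝ (secondDiffPrimitive f v h)
      (f (x + h • v) + f (x + (-h) • v) - 2 * f x) x v := by
  have hc : Continuous fun t : ℝ => f (x + t • v) := by fun_prop
  have hii : ∀ a b : ℝ, IntervalIntegrable (fun t : ℝ => f (x + t • v)) volume a b :=
    fun a b => hc.intervalIntegrable a b
  have hF : ∀ τ : ℝ, HasDerivAt (fun τ => ∫ t in (0 : ℝ)..τ, f (x + t • v)) (f (x + τ • v)) τ :=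
    fun τ => intervalIntegral.integral_hasDerivAt_right (hii _ _)
      hc.aestronglyMeasurable.stronglyMeasurableAtFilter hc.continuousAt
  have key : ∀ a τ : ℝ, (∫ t in (0 : ℝ)..a, f (x + τ • v + t • v)) =
      (∫ t in (0 : ℝ)..(τ + a), f (x + t • v)) - ∫ t in (0 : ℝ)..τ, f (x + t • v) := by
    intro a τ
    rw [intervalIntegral.integral_interval_sub_left (hii _ _) (hii _ _)]
    have := intervalIntegral.integral_comp_add_left (a := 0) (b := a)
      (fun t : ℝ => f (x + t • v)) τ
    rw [add_zero] at this
    rw [← this]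
    refine intervalIntegral.integral_congr fun t _ => ?_
    simp only [add_smul, add_assoc]
  have h1 : ∀ a : ℝ, HasDerivAt (fun τ : ℝ => ∫ t in (0 : ℝ)..a, f (x + τ • v + t • v))
      (f (x + a • v) - f x) 0 := by
    intro a
    simp only [key]
    have h2 : HasDerivAt (fun τ => ∫ t in (0 : ℝ)..(τ + a), f (x + t • v)) (f (x + a • v)) 0 := by
      have := (hF (0 + a)).comp_add_const 0 a
      simpa using this
    simpa using h2.fun_sub (hF 0)
  refine ((h1 h).fun_add (h1 (-h))).congr_deriv ?_
  ring

lemma continuous_secondDiffPrimitive {f : E → ℝ} (hf : Continuous f) (v : E) (h : ℝ) :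
    Continuous (secondDiffPrimitive f v h) := by
  unfold secondDiffPrimitive
  refine Continuous.add ?_ ?_ <;>
  exact intervalIntegral.continuous_parametric_intervalIntegral_of_continuous'
    (by simp only [Function.uncurry_def]; fun_prop) _ _

lemma IsC11.abs_secondDiffPrimitive_sub_le {f : E → ℝ} {f' : E → E →L[ℝ] ℝ} {L s : ℝ}
    (hf : IsC11 f f' L s) (hs : 0 ≤ s) (v : E) {h : ℝ} (hh : 0 ≤ h) (x : E) :
    |secondDiffPrimitive f v h x - h ^ 2 * f' x v| ≤ 2 * s * h ^ 3 * ‖v‖ ^ 2 := by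
  have hfc := hf.continuous
  have hc : Continuous fun t : ℝ => f (x + t • v) := by fun_prop
  have key : ∀ a : ℝ, |a| = h →
      |(∫ t in (0 : ℝ)..a, f (x + t • v)) - (a * f x + a ^ 2 / 2 * f' x v)|
        ≤ s * h ^ 3 * ‖v‖ ^ 2 := by
    intro a ha
    have e : (∫ t in (0 : ℝ)..a, f (x + t • v)) - (a * f x + a ^ 2 / 2 * f' x v) =
        ∫ t in (0 : ℝ)..a, (f (x + t • v) - f x - f' x (t • v)) := by
      rw [intervalIntegral.integral_sub, intervalIntegral.integral_sub]
      · simp only [map_smul, smul_eq_mul, intervalIntegral.integral_const,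
          intervalIntegral.integral_mul_const, integral_id]
        ring
      all_goals exact Continuous.intervalIntegrable (by fun_prop) _ _
    rw [e]
    have := intervalIntegral.norm_integral_le_of_norm_le_const (a := 0) (b := a)
      (f := fun t : ℝ => f (x + t • v) - f x - f' x (t • v)) (C := s * (h * ‖v‖) ^ 2) ?_
    · rw [sub_zero, ha] at this
      refine this.trans (le_of_eq (by ring))
    · intro t ht
      refine (hf.taylor hs x (t • v)).trans ?_
      rw [norm_smul]
      have : |t| ≤ h := by
        rw [← ha]
        have := Set.uIoc_subset_uIcc ht
        simpa using Set.abs_sub_left_of_mem_uIcc this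
      gcongr
      exact this
  have h1 := key h (abs_of_nonneg hh)
  have h2 := key (-h) (by rw [abs_neg, abs_of_nonneg hh])
  have h3 := abs_add_le _ _ |>.trans (add_le_add h1 h2)
  unfold secondDiffPrimitive
  refine le_trans (le_of_eq ?_) (h3.trans (le_of_eq ?_))
  · congr 1; ring
  · ring

/-- The data of the overdamped Langevin dynamics `dx = -b dt + √2 ∑ v_l dB_l` reversible with
respect to the density `w = e^{-Φ}` with `dΦ = Φ'`, with a contractive drift `b`. -/
structure IsContractiveLangevin [MeasurableSpace E] {ι : Type*} [Fintype ι] (ν : Measure E)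
    (v : ι → E) (w : E → ℝ) (Φ' : E → E →L[ℝ] ℝ) (b' : E → E →L[ℝ] E) (K C δ ε₀ : ℝ) : Prop where
  nonneg : ∀ x, 0 ≤ w x
  hasFDerivAt_weight : ∀ x, HasFDerivAt w (-(w x) • Φ' x) x
  integrable : ∀ p : ℕ, Integrable (fun x => (1 + ‖x‖) ^ p * w x) ν
  lipschitz : ∀ x y, ‖Φ' x - Φ' y‖ ≤ K * ‖x - y‖
  hasFDerivAt_drift : ∀ x, HasFDerivAt (fun y => ∑ l, Φ' y (v l) • v l) (b' x) x
  lipschitz_drift : ∀ x y, ‖b' x - b' y‖ ≤ C * ‖x - y‖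
  C_nonneg : 0 ≤ C
  δ_pos : 0 < δ
  ε₀_pos : 0 < ε₀
  contraction : ∀ ε, 0 < ε → ε ≤ ε₀ → ∀ x, ‖ContinuousLinearMap.id ℝ E - ε • b' x‖ ≤ 1 - ε * δ

/-- One step of a random walk approximating the Langevin dynamics for a time of order `h ^ 2`:
a uniform choice between a drift step and the steps `± h v_l`. -/
def walkStep {ι : Type*} [Fintype ι] (b : E → E) (v : ι → E) (h : ℝ) (f : E → ℝ) (x : E) : ℝ :=
  (1 + 2 * Fintype.card ι : ℝ)⁻¹ *
    (f (x - h ^ 2 • b x) + ∑ l, (f (x + h • v l) + f (x + (-h) • v l)))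

/-- The derivative of `walkStep b v h f`, given the derivatives of `f` and `b`. -/
def walkStepDeriv {ι : Type*} [Fintype ι] (b : E → E) (b' : E → E →L[ℝ] E) (v : ι → E) (h : ℝ)
    (f' : E → E →L[ℝ] ℝ) (x : E) : E →L[ℝ] ℝ :=
  (1 + 2 * Fintype.card ι : ℝ)⁻¹ •
    ((f' (x - h ^ 2 • b x)).comp (ContinuousLinearMap.id ℝ E - h ^ 2 • b' x) +
      ∑ l, (f' (x + h • v l) + f' (x + (-h) • v l)))

namespace IsContractiveLangevin

variable [MeasurableSpace E] {ι : Type*} [Fintype ι] {ν : Measure E}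
  {v : ι → E} {w : E → ℝ} {Φ' : E → E →L[ℝ] ℝ} {b' : E → E →L[ℝ] E} {K C δ ε₀ : ℝ}
  {f : E → ℝ} {f' : E → E →L[ℝ] ℝ} {L s : ℝ}

lemma continuous_weight (H : IsContractiveLangevin ν v w Φ' b' K C δ ε₀) : Continuous w :=
  continuous_iff_continuousAt.2 fun x => (H.hasFDerivAt_weight x).continuousAt

lemma continuous_drift (H : IsContractiveLangevin ν v w Φ' b' K C δ ε₀) :
    Continuous (fun y => ∑ l, Φ' y (v l) • v l) :=
  continuous_iff_continuousAt.2 fun x => (H.hasFDerivAt_drift x).continuousAt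

lemma continuous_grad (H : IsContractiveLangevin ν v w Φ' b' K C δ ε₀) : Continuous Φ' :=
  continuous_of_norm_sub_le H.lipschitz

lemma hasPolyGrowth_grad (H : IsContractiveLangevin ν v w Φ' b' K C δ ε₀) (u : E) :
    HasPolyGrowth (fun x => Φ' x u) := by
  refine HasPolyGrowth.mono (H.continuous_grad.clm_apply continuous_const)
    ((HasPolyGrowth.norm_of_lipschitz H.lipschitz).mul (HasPolyGrowth.const ‖u‖)) fun x => ?_
  exact (Φ' x).le_opNorm u

lemma hasPolyGrowth_norm_drift (H : IsContractiveLangevin ν v w Φ' b' K C δ ε₀) :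
    HasPolyGrowth (fun y => ‖∑ l, Φ' y (v l) • v l‖) := by
  refine HasPolyGrowth.mono H.continuous_drift.norm
    (HasPolyGrowth.sum Finset.univ fun l =>
      (H.hasPolyGrowth_grad (v l)).abs.mul (HasPolyGrowth.const ‖v l‖)) fun x => ?_
  rw [abs_norm]
  refine (norm_sum_le _ _).trans (le_of_eq ?_)
  simp [norm_smul]

lemma hasPolyGrowth_comp_drift (H : IsContractiveLangevin ν v w Φ' b' K C δ ε₀)
    (hf : IsC11 f f' L s) (ε : ℝ) :
    HasPolyGrowth (fun x => f (x - ε • ∑ l, Φ' x (v l) • v l)) := by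
  have hcont : Continuous (fun x => x - ε • ∑ l, Φ' x (v l) • v l) :=
    continuous_id.sub (H.continuous_drift.const_smul ε)
  refine hf.hasPolyGrowth_comp hcont (HasPolyGrowth.mono hcont.norm
    (HasPolyGrowth.norm.add ((HasPolyGrowth.const |ε|).mul H.hasPolyGrowth_norm_drift)) fun x => ?_)
  rw [abs_norm]
  exact (norm_sub_le _ _).trans (by rw [norm_smul, Real.norm_eq_abs])

lemma integrable_mul [BorelSpace E] [SecondCountableTopology E]
    (H : IsContractiveLangevin ν v w Φ' b' K C δ ε₀) {F : E → ℝ} (hF : HasPolyGrowth F) :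
    Integrable (fun x => F x * w x) ν :=
  hF.integrable_mul H.continuous_weight H.nonneg H.integrable

lemma norm_step_sub_le (H : IsContractiveLangevin ν v w Φ' b' K C δ ε₀) {ε : ℝ} (h0 : 0 < ε)
    (h1 : ε ≤ ε₀) (x y : E) :
    ‖(x - ε • ∑ l, Φ' x (v l) • v l) - (y - ε • ∑ l, Φ' y (v l) • v l)‖ ≤
      (1 - ε * δ) * ‖x - y‖ :=
  convex_univ.norm_image_sub_le_of_norm_hasFDerivWithin_le
    (f := fun x => x - ε • ∑ l, Φ' x (v l) • v l)
    (fun z _ => ((hasFDerivAt_id z).fun_sub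
      ((H.hasFDerivAt_drift z).fun_const_smul ε)).hasFDerivWithinAt)
    (fun z _ => H.contraction ε h0 h1 z) (Set.mem_univ y) (Set.mem_univ x)

lemma isC11_walkStep (H : IsContractiveLangevin ν v w Φ' b' K C δ ε₀) (hf : IsC11 f f' L s)
    (hs : 0 ≤ s) {h : ℝ} (h0 : 0 < h) (h1 : h ^ 2 ≤ ε₀) :
    IsC11 (walkStep (fun y => ∑ l, Φ' y (v l) • v l) v h f)
      (walkStepDeriv (fun y => ∑ l, Φ' y (v l) • v l) b' v h f')
      ((1 - (1 + 2 * Fintype.card ι : ℝ)⁻¹ * h ^ 2 * δ) * L)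
      ((1 - (1 + 2 * Fintype.card ι : ℝ)⁻¹ * h ^ 2 * δ) * s +
        (1 + 2 * Fintype.card ι : ℝ)⁻¹ * h ^ 2 * C * L) := by
  have hN : (0 : ℝ) < 1 + 2 * Fintype.card ι := by positivity
  have hh : 0 < h ^ 2 := by positivity
  have hL := hf.L_nonneg
  have hq : 0 ≤ 1 - h ^ 2 * δ := (norm_nonneg _).trans (H.contraction _ hh h1 0)
  have hq1 : 1 - h ^ 2 * δ ≤ 1 := by linarith [mul_pos hh H.δ_pos]
  refine ⟨fun x => ?_, fun x => ?_, fun x y => ?_⟩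
  · refine HasFDerivAt.const_mul ?_ _
    refine HasFDerivAt.fun_add ?_ (HasFDerivAt.fun_sum fun l _ => HasFDerivAt.fun_add ?_ ?_)
    · exact (hf.hasFDerivAt _).comp x ((hasFDerivAt_id x).fun_sub
        ((H.hasFDerivAt_drift x).fun_const_smul (h ^ 2)))
    · exact hasFDerivAt_comp_add_right _ |>.2 (hf.hasFDerivAt _)
    · exact hasFDerivAt_comp_add_right _ |>.2 (hf.hasFDerivAt _)
  · unfold walkStepDeriv
    rw [norm_smul, Real.norm_of_nonneg (by positivity), inv_mul_le_iff₀ hN]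
    calc _ ≤ L * (1 - h ^ 2 * δ) + ∑ l : ι, (L + L) := by
          refine norm_add_le_of_le ?_ (norm_sum_le_of_le _ fun l _ =>
            norm_add_le_of_le (hf.norm_le _) (hf.norm_le _))
          refine (ContinuousLinearMap.opNorm_comp_le _ _).trans ?_
          exact mul_le_mul (hf.norm_le _) (H.contraction _ hh h1 x) (norm_nonneg _) hL
      _ = _ := by
          simp only [Finset.sum_const, Finset.card_univ, nsmul_eq_mul]
          field_simp
          ring
  · unfold walkStepDeriv
    refine (congrArg norm (smul_sub _ _ _).symm).le.trans ?_
    rw [norm_smul, Real.norm_of_nonneg (by positivity), inv_mul_le_iff₀ hN,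
      add_sub_add_comm, ← Finset.sum_sub_distrib]
    set T : E → E := fun x => x - h ^ 2 • ∑ l, Φ' x (v l) • v l with hT
    have hTxy : ‖T x - T y‖ ≤ (1 - h ^ 2 * δ) * ‖x - y‖ := H.norm_step_sub_le hh h1 x y
    calc _ ≤ ((1 - h ^ 2 * δ) * (s * ‖x - y‖) + L * (h ^ 2 * (C * ‖x - y‖))) +
          ∑ l : ι, (s * ‖x - y‖ + s * ‖x - y‖) := by
          refine norm_add_le_of_le ?_ (norm_sum_le_of_le _ fun l _ => ?_)
          · have e : (f' (T x)).comp (ContinuousLinearMap.id ℝ E - h ^ 2 • b' x) -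
                (f' (T y)).comp (ContinuousLinearMap.id ℝ E - h ^ 2 • b' y) =
                (f' (T x) - f' (T y)).comp (ContinuousLinearMap.id ℝ E - h ^ 2 • b' x) +
                (f' (T y)).comp (h ^ 2 • (b' y - b' x)) := by
              ext u
              simp only [sub_apply, ContinuousLinearMap.comp_apply,
                add_apply, smul_apply, map_sub, map_smul,
                ContinuousLinearMap.id_apply, smul_eq_mul]
              ring
            refine (congrArg norm e).le.trans (norm_add_le_of_le ?_ ?_)
            · refine (ContinuousLinearMap.opNorm_comp_le _ _).trans ?_
              rw [mul_comm]
              refine mul_le_mul (H.contraction _ hh h1 x) ?_ (norm_nonneg _) hq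
              refine (hf.lipschitz _ _).trans ?_
              gcongr
              exact hTxy.trans (mul_le_of_le_one_left (norm_nonneg _) hq1)
            · refine (ContinuousLinearMap.opNorm_comp_le _ _).trans ?_
              refine mul_le_mul (hf.norm_le _) ?_ (norm_nonneg _) hL
              rw [norm_smul, Real.norm_of_nonneg hh.le, norm_sub_rev]
              gcongr
              exact H.lipschitz_drift x y
          · rw [add_sub_add_comm]
            refine norm_add_le_of_le ?_ ?_ <;>
            exact (hf.lipschitz _ _).trans (le_of_eq (by rw [add_sub_add_right_eq_sub]))
      _ = _ := by
          simp only [Finset.sum_const, Finset.card_univ, nsmul_eq_mul]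
          field_simp
          ring

/-- The error made when replacing the drift step by its linearization. -/
lemma abs_integral_drift_sub_le [BorelSpace E] [SecondCountableTopology E]
    (H : IsContractiveLangevin ν v w Φ' b' K C δ ε₀) (hf : IsC11 f f' L s) (hs : 0 ≤ s)
    {g : E → ℝ} (hg : HasPolyGrowth g) (ε : ℝ) :
    |(∫ x, (f x - f (x - ε • ∑ l, Φ' x (v l) • v l)) * g x * w x ∂ν) -
        ε * ∫ x, f' x (∑ l, Φ' x (v l) • v l) * g x * w x ∂ν| ≤
      s * ε ^ 2 * ∫ x, ‖∑ l, Φ' x (v l) • v l‖ ^ 2 * |g x| * w x ∂ν := by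
  have hb := H.hasPolyGrowth_norm_drift
  have i1 := H.integrable_mul ((hf.hasPolyGrowth.sub (H.hasPolyGrowth_comp_drift hf ε)).mul hg)
  have i2 := H.integrable_mul ((hf.hasPolyGrowth_deriv H.continuous_drift hb).mul hg)
  have i3 := H.integrable_mul ((hb.mul hb).mul hg.abs)
  rw [← integral_const_mul, ← integral_sub i1 (i2.const_mul ε), ← integral_const_mul]
  rw [← Real.norm_eq_abs]
  refine norm_integral_le_of_norm_le (Integrable.const_mul (by simpa only [pow_two] using i3) _)
    (ae_of_all _ fun x => ?_)
  set B := ∑ l, Φ' x (v l) • v l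
  have ht := hf.taylor hs x (-(ε • B))
  rw [norm_neg, norm_smul, mul_pow, Real.norm_eq_abs, sq_abs, ← sub_eq_add_neg, map_neg,
    map_smul, smul_eq_mul] at ht
  have e : (f x - f (x - ε • B)) * g x * w x - ε * (f' x B * g x * w x) =
      -((f (x - ε • B) - f x - -(ε * f' x B)) * (g x * w x)) := by ring
  rw [e, norm_neg, Real.norm_eq_abs, abs_mul, abs_mul (g x), abs_of_nonneg (H.nonneg x)]
  refine (mul_le_mul_of_nonneg_right ht (mul_nonneg (abs_nonneg _) (H.nonneg x))).trans
    (le_of_eq (by ring))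

/-- The error made when replacing a symmetric second difference by the second derivative,
integrated by parts. -/
lemma abs_integral_secondDiff_sub_le [BorelSpace E] [FiniteDimensional ℝ E]
    [ν.IsAddHaarMeasure]
    (H : IsContractiveLangevin ν v w Φ' b' K C δ ε₀) (hf : IsC11 f f' L s) (hs : 0 ≤ s)
    {g : E → ℝ} (hg : HasPolyGrowth g) {g' : E →L[ℝ] ℝ} (hg' : ∀ x, HasFDerivAt g g' x)
    (u : E) {h : ℝ} (h0 : 0 ≤ h) :
    |(∫ x, (2 * f x - (f (x + h • u) + f (x + (-h) • u))) * g x * w x ∂ν) -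
        h ^ 2 * ∫ x, f' x u * (g' u - g x * Φ' x u) * w x ∂ν| ≤
      s * h ^ 3 * (2 * ‖u‖ ^ 2 * ∫ x, |g' u - g x * Φ' x u| * w x ∂ν) := by
  have : ProperSpace E := FiniteDimensional.proper ℝ E
  set W := secondDiffPrimitive f u h
  have hWb : ∀ x, |W x - h ^ 2 * f' x u| ≤ 2 * s * h ^ 3 * ‖u‖ ^ 2 :=
    hf.abs_secondDiffPrimitive_sub_le hs u h0
  have hfu : HasPolyGrowth (fun x => f' x u) :=
    hf.hasPolyGrowth_deriv continuous_const (HasPolyGrowth.const ‖u‖)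
  have hW : HasPolyGrowth W := by
    refine HasPolyGrowth.mono (continuous_secondDiffPrimitive hf.continuous u h)
      ((HasPolyGrowth.const (2 * s * h ^ 3 * ‖u‖ ^ 2)).add
        ((HasPolyGrowth.const (h ^ 2)).mul hfu).abs) fun x => ?_
    have h1 := hWb x
    have h2 := abs_sub_abs_le_abs_sub (W x) (h ^ 2 * f' x u)
    linarith
  have hk : HasPolyGrowth (fun x => g' u - g x * Φ' x u) :=
    (HasPolyGrowth.const _).sub (hg.mul (H.hasPolyGrowth_grad u))
  have hD : HasPolyGrowth (fun x => f (x + h • u) + f (x + (-h) • u) - 2 * f x) :=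
    ((hf.hasPolyGrowth_shift _).add (hf.hasPolyGrowth_shift _)).sub
      ((HasPolyGrowth.const 2).mul hf.hasPolyGrowth)
  have i1 := H.integrable_mul (hW.mul hk)
  have i2 := H.integrable_mul (hD.mul hg)
  have ibp : ∫ x, W x * ((g' u - g x * Φ' x u) * w x) ∂ν =
      -∫ x, (f (x + h • u) + f (x + (-h) • u) - 2 * f x) * (g x * w x) ∂ν := by
    refine integral_bilinear_hasLineDerivAt_right_eq_neg_left_of_integrable
      (B := ContinuousLinearMap.mul ℝ ℝ) (v := u) (μ := ν)
      (f := W) (f' := fun x => f (x + h • u) + f (x + (-h) • u) - 2 * f x)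
      (g := fun x => g x * w x) (g' := fun x => (g' u - g x * Φ' x u) * w x)
      ?_ ?_ ?_ ?_ ?_
    · simpa only [ContinuousLinearMap.mul_apply', mul_assoc] using i2
    · simpa only [ContinuousLinearMap.mul_apply', mul_assoc] using i1
    · simpa only [ContinuousLinearMap.mul_apply', mul_assoc] using H.integrable_mul (hW.mul hg)
    · exact fun x _ => hasLineDerivAt_secondDiffPrimitive hf.continuous u h x
    · intro x _
      have := ((hg' x).fun_mul (H.hasFDerivAt_weight x)).hasLineDerivAt u
      convert this using 1
      simp
      ring
  have e : ∫ x, (2 * f x - (f (x + h • u) + f (x + (-h) • u))) * g x * w x ∂ν =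
      ∫ x, W x * (g' u - g x * Φ' x u) * w x ∂ν := by
    simp only [mul_assoc] at ibp ⊢
    rw [ibp, ← integral_neg]
    exact integral_congr_ae (ae_of_all _ fun x => by ring)
  rw [e, ← integral_const_mul, ← mul_assoc, ← integral_const_mul,
    ← integral_sub i1 ((H.integrable_mul (hfu.mul hk)).const_mul _)]
  rw [← Real.norm_eq_abs]
  refine norm_integral_le_of_norm_le ((H.integrable_mul hk.abs).const_mul _)
    (ae_of_all _ fun x => ?_)
  have e2 : W x * (g' u - g x * Φ' x u) * w x - h ^ 2 * (f' x u * (g' u - g x * Φ' x u) * w x) =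
      (W x - h ^ 2 * f' x u) * ((g' u - g x * Φ' x u) * w x) := by ring
  rw [e2, Real.norm_eq_abs, abs_mul, abs_mul _ (w x), abs_of_nonneg (H.nonneg x)]
  exact (mul_le_mul_of_nonneg_right (hWb x) (mul_nonneg (abs_nonneg _) (H.nonneg x))).trans
    (le_of_eq (by ring))

lemma abs_integral_sub_walkStep_le [BorelSpace E] [FiniteDimensional ℝ E] [ν.IsAddHaarMeasure]
    (H : IsContractiveLangevin ν v w Φ' b' K C δ ε₀)
    {g : E → ℝ} (hg : HasPolyGrowth g) {g' : E →L[ℝ] ℝ} (hg' : ∀ x, HasFDerivAt g g' x) :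
    ∃ R : ℝ, 0 ≤ R ∧ ∀ (f : E → ℝ) (f' : E → E →L[ℝ] ℝ) (L s h : ℝ), IsC11 f f' L s → 0 ≤ s →
      0 < h → h ≤ 1 →
      |∫ x, (f x - walkStep (fun y => ∑ l, Φ' y (v l) • v l) v h f x) * g x * w x ∂ν| ≤
        (1 + 2 * Fintype.card ι : ℝ)⁻¹ *
          (h ^ 2 * (L * ‖∑ l, g' (v l) • v l‖ * ∫ x, w x ∂ν) + s * h ^ 3 * R) := by
  have : ProperSpace E := FiniteDimensional.proper ℝ E
  set R₁ := ∫ x, ‖∑ l, Φ' x (v l) • v l‖ ^ 2 * |g x| * w x ∂ν with hR₁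
  set R₂ : ι → ℝ := fun l => 2 * ‖v l‖ ^ 2 * ∫ x, |g' (v l) - g x * Φ' x (v l)| * w x ∂ν with hR₂
  have hR₁0 : 0 ≤ R₁ := integral_nonneg fun x => by have := H.nonneg x; positivity
  have hR₂0 : ∀ l, 0 ≤ R₂ l := fun l => mul_nonneg (by positivity)
    (integral_nonneg fun x => by have := H.nonneg x; positivity)
  refine ⟨R₁ + ∑ l, R₂ l, add_nonneg hR₁0 (Finset.sum_nonneg fun l _ => hR₂0 l), ?_⟩
  intro f f' L s h hf hs h0 h1
  have hb := H.hasPolyGrowth_norm_drift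
  have hfv : ∀ u, HasPolyGrowth (fun x => f' x u) := fun u =>
    hf.hasPolyGrowth_deriv continuous_const (HasPolyGrowth.const ‖u‖)
  have iT := H.integrable_mul ((hf.hasPolyGrowth.sub (H.hasPolyGrowth_comp_drift hf (h ^ 2))).mul hg)
  have iD : ∀ l, Integrable
      (fun x => (2 * f x - (f (x + h • v l) + f (x + (-h) • v l))) * g x * w x) ν := fun l =>
    H.integrable_mul ((((HasPolyGrowth.const 2).mul hf.hasPolyGrowth).sub
      ((hf.hasPolyGrowth_shift _).add (hf.hasPolyGrowth_shift _))).mul hg)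
  have jT := H.integrable_mul ((hf.hasPolyGrowth_deriv H.continuous_drift hb).mul hg)
  have jD : ∀ l, Integrable (fun x => f' x (v l) * (g' (v l) - g x * Φ' x (v l)) * w x) ν :=
    fun l => H.integrable_mul ((hfv _).mul
      ((HasPolyGrowth.const _).sub (hg.mul (H.hasPolyGrowth_grad _))))
  have eI : ∫ x, (f x - walkStep (fun y => ∑ l, Φ' y (v l) • v l) v h f x) * g x * w x ∂ν =
      (1 + 2 * Fintype.card ι : ℝ)⁻¹ *
        ((∫ x, (f x - f (x - h ^ 2 • ∑ l, Φ' x (v l) • v l)) * g x * w x ∂ν) +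
          ∑ l, ∫ x, (2 * f x - (f (x + h • v l) + f (x + (-h) • v l))) * g x * w x ∂ν) := by
    rw [← integral_finsetSum _ fun l _ => iD l,
      ← integral_add iT (integrable_finsetSum _ fun l _ => iD l), ← integral_const_mul]
    refine integral_congr_ae (ae_of_all _ fun x => ?_)
    have hN : (1 + 2 * Fintype.card ι : ℝ) ≠ 0 := by positivity
    simp only [walkStep, ← Finset.sum_mul, Finset.sum_sub_distrib, Finset.sum_const,
      Finset.card_univ, nsmul_eq_mul]
    field_simp
    ring
  have eJ : (∫ x, f' x (∑ l, Φ' x (v l) • v l) * g x * w x ∂ν) +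
      ∑ l, ∫ x, f' x (v l) * (g' (v l) - g x * Φ' x (v l)) * w x ∂ν =
      ∫ x, f' x (∑ l, g' (v l) • v l) * w x ∂ν := by
    rw [← integral_finsetSum _ fun l _ => jD l,
      ← integral_add jT (integrable_finsetSum _ fun l _ => jD l)]
    refine integral_congr_ae (ae_of_all _ fun x => ?_)
    simp only [map_sum, map_smul, smul_eq_mul, Finset.sum_mul, ← Finset.sum_add_distrib]
    exact Finset.sum_congr rfl fun l _ => by ring
  have hJ : |∫ x, f' x (∑ l, g' (v l) • v l) * w x ∂ν| ≤
      L * ‖∑ l, g' (v l) • v l‖ * ∫ x, w x ∂ν := by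
    rw [← integral_const_mul, ← Real.norm_eq_abs]
    refine norm_integral_le_of_norm_le
      ((by simpa using H.integrable 0 : Integrable w ν).const_mul _) (ae_of_all _ fun x => ?_)
    rw [norm_mul, Real.norm_of_nonneg (H.nonneg x)]
    exact mul_le_mul_of_nonneg_right (((f' x).le_opNorm _).trans
      (mul_le_mul_of_nonneg_right (hf.norm_le x) (norm_nonneg _))) (H.nonneg x)
  rw [eI, abs_mul, abs_of_nonneg (by positivity)]
  refine mul_le_mul_of_nonneg_left ?_ (by positivity)
  have bT := H.abs_integral_drift_sub_le hf hs hg (h ^ 2)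
  have bD := Finset.sum_le_sum fun l (_ : l ∈ Finset.univ) =>
    H.abs_integral_secondDiff_sub_le hf hs hg hg' (v l) h0.le
  have bD' := (Finset.abs_sum_le_sum_abs _ _).trans bD
  rw [Finset.sum_sub_distrib, ← Finset.mul_sum, ← Finset.mul_sum] at bD'
  rw [← eJ] at hJ
  have hh : s * (h ^ 2) ^ 2 * R₁ ≤ s * h ^ 3 * R₁ := by
    have : (h ^ 2) ^ 2 ≤ h ^ 3 := by
      calc (h ^ 2) ^ 2 = h ^ 3 * h := by ring
        _ ≤ h ^ 3 * 1 := by gcongr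
        _ = h ^ 3 := mul_one _
    gcongr
  have hJ' := mul_le_mul_of_nonneg_left hJ (sq_nonneg h)
  rw [← abs_of_nonneg (sq_nonneg h), ← abs_mul, abs_of_nonneg (sq_nonneg h)] at hJ'
  have tri : ∀ a b c d : ℝ, |a + b| ≤ |a - h ^ 2 * c| + |b - h ^ 2 * d| + |h ^ 2 * (c + d)| := by
    intro a b c d
    calc |a + b| = |(a - h ^ 2 * c) + (b - h ^ 2 * d) + h ^ 2 * (c + d)| := by congr 1; ring
      _ ≤ _ := abs_add_three _ _ _
  refine (tri _ _ _ _).trans ((add_le_add (add_le_add (bT.trans hh) bD') hJ').trans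
    (le_of_eq (by ring)))

/-- Iteration of the random walk: the contribution of the initial observable is transported to the
iterates, whose derivatives decay geometrically. -/
lemma abs_integral_le_iterate [BorelSpace E] [FiniteDimensional ℝ E]
    (H : IsContractiveLangevin ν v w Φ' b' K C δ ε₀)
    {g : E → ℝ} (hg : HasPolyGrowth g) (hg0 : ∫ x, g x * w x ∂ν = 0) {a R h : ℝ}
    (ha : 0 ≤ a) (hR : 0 ≤ R) (h0 : 0 < h) (h1 : h ^ 2 ≤ ε₀)
    (hstep : ∀ (f : E → ℝ) (f' : E → E →L[ℝ] ℝ) (L s : ℝ), IsC11 f f' L s → 0 ≤ s →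
      |∫ x, (f x - walkStep (fun y => ∑ l, Φ' y (v l) • v l) v h f x) * g x * w x ∂ν| ≤
        (1 + 2 * Fintype.card ι : ℝ)⁻¹ * (h ^ 2 * (L * a) + s * h ^ 3 * R)) (n : ℕ) :
    ∀ (f : E → ℝ) (f' : E → E →L[ℝ] ℝ) (L s : ℝ), IsC11 f f' L s → 0 ≤ s →
      |∫ x, f x * g x * w x ∂ν| ≤
        (a + h * R / δ * C) / δ * L + h * R / δ * s +
          (1 - (1 + 2 * Fintype.card ι : ℝ)⁻¹ * h ^ 2 * δ) ^ n * L *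
            ∫ x, ‖x‖ * |g x| * w x ∂ν := by
  have : ProperSpace E := FiniteDimensional.proper ℝ E
  have hδ := H.δ_pos
  have hC := H.C_nonneg
  set p : ℝ := (1 + 2 * Fintype.card ι : ℝ)⁻¹ with hp
  have hp0 : 0 < p := by positivity
  induction n with
  | zero =>
    intro f f' L s hf hs
    have hL := hf.L_nonneg
    have hbase : |∫ x, f x * g x * w x ∂ν| ≤ L * ∫ x, ‖x‖ * |g x| * w x ∂ν := by
      have i1 := H.integrable_mul (hf.hasPolyGrowth.mul hg)
      have i2 := H.integrable_mul hg
      have e : ∫ x, f x * g x * w x ∂ν =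
          ∫ x, (f x * g x * w x - f 0 * (g x * w x)) ∂ν := by
        rw [integral_sub i1 (i2.const_mul _), integral_const_mul, hg0, mul_zero, sub_zero]
      rw [e, ← integral_const_mul, ← Real.norm_eq_abs]
      refine norm_integral_le_of_norm_le
        ((H.integrable_mul (HasPolyGrowth.norm.mul hg.abs)).const_mul _)
        (ae_of_all _ fun x => ?_)
      have e2 : f x * g x * w x - f 0 * (g x * w x) = (f x - f 0) * (g x * w x) := by ring
      rw [e2, Real.norm_eq_abs, abs_mul, abs_mul (g x), abs_of_nonneg (H.nonneg x)]
      have h3 := hf.abs_sub_le x 0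
      rw [sub_zero] at h3
      refine (mul_le_mul_of_nonneg_right h3 (mul_nonneg (abs_nonneg _) (H.nonneg x))).trans
        (le_of_eq (by ring))
    have h5 : 0 ≤ (a + h * R / δ * C) / δ * L + h * R / δ * s := by positivity
    rw [pow_zero, one_mul]
    linarith
  | succ n ih =>
    intro f f' L s hf hs
    have hL := hf.L_nonneg
    have hq : 0 ≤ 1 - h ^ 2 * δ :=
      (norm_nonneg _).trans (H.contraction _ (by positivity) h1 0)
    have hp1 : p ≤ 1 := by
      rw [hp]
      exact inv_le_one_of_one_le₀ (by simp)
    have hη : 0 ≤ 1 - p * h ^ 2 * δ := by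
      have : p * (h ^ 2 * δ) ≤ 1 * (h ^ 2 * δ) := by gcongr
      linarith
    have hPf := H.isC11_walkStep hf hs h0 h1
    have h2 := hstep f f' L s hf hs
    have h3 := ih _ _ _ _ hPf (by positivity)
    have e : ∫ x, f x * g x * w x ∂ν =
        (∫ x, (f x - walkStep (fun y => ∑ l, Φ' y (v l) • v l) v h f x) * g x * w x ∂ν) +
        ∫ x, walkStep (fun y => ∑ l, Φ' y (v l) • v l) v h f x * g x * w x ∂ν := by
      rw [← integral_add
        (H.integrable_mul ((hf.hasPolyGrowth.sub hPf.hasPolyGrowth).mul hg))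
        (H.integrable_mul (hPf.hasPolyGrowth.mul hg))]
      exact integral_congr_ae (ae_of_all _ fun x => by ring)
    rw [e]
    refine (abs_add_le _ _).trans ((add_le_add h2 h3).trans (le_of_eq ?_))
    rw [← hp]
    field_simp
    ring

/-- Covariance estimate for linear observables of a measure reversible with respect to a
contractive Langevin dynamics. -/
lemma abs_integral_clm_mul_le [BorelSpace E] [FiniteDimensional ℝ E] [ν.IsAddHaarMeasure]
    (H : IsContractiveLangevin ν v w Φ' b' K C δ ε₀) (φ ψ : E →L[ℝ] ℝ) (m : ℝ)
    (hm : ∫ x, (ψ x - m) * w x ∂ν = 0) :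
    |∫ x, φ x * (ψ x - m) * w x ∂ν| ≤
      (‖∑ l, ψ (v l) • v l‖ * ∫ x, w x ∂ν) / δ * ‖φ‖ := by
  have clm : ∀ χ : E →L[ℝ] ℝ, IsC11 χ (fun _ => χ) ‖χ‖ 0 := fun χ =>
    ⟨fun x => χ.hasFDerivAt, fun x => le_rfl, fun x y => by simp⟩
  have hg : HasPolyGrowth (fun x => ψ x - m) :=
    (clm ψ).hasPolyGrowth.sub (HasPolyGrowth.const m)
  obtain ⟨R, hR, hstep⟩ := H.abs_integral_sub_walkStep_le hg (g' := ψ)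
    fun x => ψ.hasFDerivAt.sub_const m
  set a := ‖∑ l, ψ (v l) • v l‖ * ∫ x, w x ∂ν with ha
  have ha0 : 0 ≤ a := mul_nonneg (norm_nonneg _) (integral_nonneg H.nonneg)
  have key : ∀ h : ℝ, 0 < h → h ≤ 1 → h ^ 2 ≤ ε₀ →
      |∫ x, φ x * (ψ x - m) * w x ∂ν| ≤ (a + h * R / δ * C) / δ * ‖φ‖ := by
    intro h h0 h1 h2
    have hq : 0 ≤ 1 - h ^ 2 * δ :=
      (norm_nonneg _).trans (H.contraction _ (by positivity) h2 0)
    have hδ := H.δ_pos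
    set p : ℝ := (1 + 2 * Fintype.card ι : ℝ)⁻¹ with hp
    have hp0 : 0 < p := by positivity
    have hp1 : p ≤ 1 := by
      rw [hp]
      exact inv_le_one_of_one_le₀ (by simp)
    have hη : 0 ≤ 1 - p * h ^ 2 * δ := by
      have : p * (h ^ 2 * δ) ≤ 1 * (h ^ 2 * δ) := by gcongr
      linarith
    have hη1 : 1 - p * h ^ 2 * δ < 1 := by
      have : 0 < p * h ^ 2 * δ := by positivity
      linarith
    have hn := H.abs_integral_le_iterate hg hm ha0 hR h0 h2
      (fun f f' L s hf hs => by
        simpa only [mul_assoc, ha] using hstep f f' L s h hf hs h0 h1)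
    have hlim := (((tendsto_pow_atTop_nhds_zero_of_lt_one hη hη1).mul_const ‖φ‖).mul_const
      (∫ x, ‖x‖ * |ψ x - m| * w x ∂ν)).const_add
        ((a + h * R / δ * C) / δ * ‖φ‖ + h * R / δ * 0)
    have := ge_of_tendsto' hlim fun n => hn n φ _ _ _ (clm φ) le_rfl
    simpa using this
  have hlim : Tendsto (fun h : ℝ => (a + h * R / δ * C) / δ * ‖φ‖) (nhdsWithin 0 (Set.Ioi 0))
      (nhds (a / δ * ‖φ‖)) := by
    have hc : Continuous (fun h : ℝ => (a + h * R / δ * C) / δ * ‖φ‖) := by fun_prop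
    simpa using (hc.tendsto 0).mono_left nhdsWithin_le_nhds
  refine ge_of_tendsto hlim ?_
  have hev : ∀ᶠ h : ℝ in nhds 0, h < 1 ∧ h ^ 2 < ε₀ := by
    refine (eventually_lt_nhds one_pos).and ?_
    have hc : Continuous (fun h : ℝ => h ^ 2) := by fun_prop
    have := hc.tendsto 0
    exact this.eventually_lt_const (by simpa using H.ε₀_pos)
  filter_upwards [self_mem_nhdsWithin, nhdsWithin_le_nhds hev] with h h0 h1
  exact key h h0 h1.1.le h1.2.le

end IsContractiveLangevin

end Langevin

section Gibbs

lemma norm_id_sub_smul_le {V : Type*} [NormedAddCommGroup V] [InnerProductSpace ℝ V]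
    {A : V →L[ℝ] V} {B δ₀ ε : ℝ} (hA : ‖A‖ ≤ B) (hδ₀ : 0 ≤ δ₀) (hδ₁ : δ₀ ≤ 1)
    (hcoer : ∀ u, δ₀ * ‖u‖ ^ 2 ≤ inner ℝ u (A u)) (hε : 0 < ε)
    (hε₁ : ε ≤ 1) (hεB : ε * B ^ 2 ≤ δ₀) :
    ‖ContinuousLinearMap.id ℝ V - ε • A‖ ≤ 1 - ε * (δ₀ / 2) := by
  have h0 : 0 ≤ 1 - ε * (δ₀ / 2) := by nlinarith
  refine ContinuousLinearMap.opNorm_le_bound _ h0 fun u => ?_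
  refine le_of_sq_le_sq ?_ (by positivity)
  have hAu : ‖A u‖ ≤ B * ‖u‖ := A.le_of_opNorm_le hA u
  have h1 : ‖u - ε • A u‖ ^ 2 = ‖u‖ ^ 2 - 2 * (ε * inner ℝ u (A u)) + ε ^ 2 * ‖A u‖ ^ 2 := by
    rw [norm_sub_sq_real, inner_smul_right, norm_smul, mul_pow, Real.norm_eq_abs, sq_abs]
  have h2 : ‖A u‖ ^ 2 ≤ (B * ‖u‖) ^ 2 := by gcongr
  have h3 := mul_le_mul_of_nonneg_left (hcoer u) hε.le
  have h4 := mul_le_mul_of_nonneg_left h2 (sq_nonneg ε)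
  have h5 : ε * (ε * B ^ 2) * ‖u‖ ^ 2 ≤ ε * δ₀ * ‖u‖ ^ 2 := by gcongr
  calc ‖(ContinuousLinearMap.id ℝ V - ε • A) u‖ ^ 2 = ‖u - ε • A u‖ ^ 2 := by simp
    _ ≤ (1 - ε * δ₀) * ‖u‖ ^ 2 := by rw [h1]; nlinarith
    _ ≤ ((1 - ε * (δ₀ / 2)) * ‖u‖) ^ 2 := by nlinarith [sq_nonneg (ε * (δ₀ / 2) * ‖u‖)]

/-- The diagonal scaling of `EuclideanSpace ℝ ι` by nonzero weights. -/
def diagEquiv {ι : Type*} [Fintype ι] (ρ : ι → ℝ) (hρ : ∀ l, ρ l ≠ 0) :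
    EuclideanSpace ℝ ι ≃L[ℝ] EuclideanSpace ℝ ι :=
  LinearEquiv.toContinuousLinearEquiv
    { toFun := fun x => WithLp.toLp 2 fun l => ρ l * x l
      invFun := fun x => WithLp.toLp 2 fun l => (ρ l)⁻¹ * x l
      map_add' := fun x y => by ext l; simp [mul_add]
      map_smul' := fun c x => by ext l; simp [mul_left_comm]
      left_inv := fun x => by ext l; simp [hρ l]
      right_inv := fun x => by ext l; simp [hρ l] }

@[simp] lemma diagEquiv_apply {ι : Type*} [Fintype ι] (ρ : ι → ℝ) (hρ : ∀ l, ρ l ≠ 0)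
    (x : EuclideanSpace ℝ ι) (l : ι) : diagEquiv ρ hρ x l = ρ l * x l := rfl

@[simp] lemma diagEquiv_symm_apply {ι : Type*} [Fintype ι] (ρ : ι → ℝ) (hρ : ∀ l, ρ l ≠ 0)
    (x : EuclideanSpace ℝ ι) (l : ι) : (diagEquiv ρ hρ).symm x l = (ρ l)⁻¹ * x l := rfl

variable {ι : Type*} [Fintype ι] {Ψ : EuclideanSpace ℝ ι → ℝ}

lemma integrable_one_add_norm_pow_mul_exp_neg (hΨ : Differentiable ℝ Ψ) {c : ℝ}
    (hc : ∀ x, ‖fderiv ℝ Ψ x‖ ≤ c) (p : ℕ) :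
    Integrable fun x : EuclideanSpace ℝ ι =>
      (1 + ‖x‖) ^ p * Real.exp (-(‖x‖ ^ 2 / 2 + Ψ x)) := by
  have hgauss : Integrable fun x : EuclideanSpace ℝ ι => Real.exp (-(1 / 4) * ‖x‖ ^ 2) := by
    have := GaussianFourier.integrable_cexp_neg_mul_sq_norm_add (V := EuclideanSpace ℝ ι)
      (b := ((1 / 4 : ℝ) : ℂ)) (by rw [Complex.ofReal_re]; norm_num) 0 0
    refine this.norm.congr (ae_of_all _ fun x => ?_)
    simp only [Complex.norm_exp]
    congr 1
    simp [← Complex.ofReal_pow]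
  have hΨc := hΨ.continuous
  refine (hgauss.const_mul (p.factorial * Real.exp (1 + (c + 1) ^ 2 + |Ψ 0|))).mono'
    (by fun_prop) (ae_of_all _ fun x => ?_)
  have h1 : |Ψ x - Ψ 0| ≤ c * ‖x‖ := by
    simpa using convex_univ.norm_image_sub_le_of_norm_fderiv_le
      (fun z _ => hΨ z) (fun z _ => hc z) (Set.mem_univ 0) (Set.mem_univ x)
  have h2 : (1 + ‖x‖) ^ p ≤ p.factorial * Real.exp (1 + ‖x‖) := by
    have := Real.pow_div_factorial_le_exp (1 + ‖x‖) (by positivity) p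
    rwa [div_le_iff₀ (by positivity), mul_comm] at this
  rw [Real.norm_of_nonneg (by positivity)]
  calc _ ≤ p.factorial * Real.exp (1 + ‖x‖) * Real.exp (-(‖x‖ ^ 2 / 2 + Ψ x)) := by gcongr
    _ = p.factorial * Real.exp (1 + ‖x‖ - (‖x‖ ^ 2 / 2 + Ψ x)) := by
        rw [mul_assoc, ← Real.exp_add]; rfl
    _ ≤ p.factorial * Real.exp (1 + (c + 1) ^ 2 + |Ψ 0| + -(1 / 4) * ‖x‖ ^ 2) := by
        gcongr
        have h3 := neg_abs_le (Ψ x - Ψ 0)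
        have h4 := neg_abs_le (Ψ 0)
        nlinarith [sq_nonneg (‖x‖ / 2 - (c + 1))]
    _ = _ := by rw [Real.exp_add]; ring

lemma integral_gibbs {Φ : EuclideanSpace ℝ ι → ℝ} (hΦ : Continuous Φ)
    (F : EuclideanSpace ℝ ι → ℝ) :
    ∫ x, F x ∂(gibbs Φ) = (∫ x, Real.exp (-Φ x))⁻¹ * ∫ x, F x * Real.exp (-Φ x) := by
  unfold gibbs
  rw [integral_smul_measure, integral_withDensity_eq_integral_toReal_smul (by fun_prop)
    (ae_of_all _ fun x => ENNReal.ofReal_lt_top), ENNReal.toReal_inv,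
    ENNReal.toReal_ofReal (integral_nonneg fun x => (Real.exp_pos _).le), smul_eq_mul]
  congr 1
  refine integral_congr_ae (ae_of_all _ fun x => ?_)
  simp only [ENNReal.toReal_ofReal (Real.exp_pos _).le, smul_eq_mul]
  ring

/-- The inner product of a real inner product space as a bilinear map. -/
def innerCLM (V : Type*) [NormedAddCommGroup V] [InnerProductSpace ℝ V] :
    V →L[ℝ] V →L[ℝ] ℝ := innerSL ℝ

@[simp] lemma innerCLM_apply {V : Type*} [NormedAddCommGroup V] [InnerProductSpace ℝ V]
    (x y : V) : innerCLM V x y = inner ℝ x y := rfl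

/-- The derivative of `‖y‖ ^ 2 / 2 + Ψ y`. -/
def potDeriv (Ψ : EuclideanSpace ℝ ι → ℝ) (x : EuclideanSpace ℝ ι) :
    EuclideanSpace ℝ ι →L[ℝ] ℝ :=
  innerCLM _ x + fderiv ℝ Ψ x

/-- The second derivative of `‖y‖ ^ 2 / 2 + Ψ y`. -/
def potDeriv₂ (Ψ : EuclideanSpace ℝ ι → ℝ) (x : EuclideanSpace ℝ ι) :
    EuclideanSpace ℝ ι →L[ℝ] EuclideanSpace ℝ ι →L[ℝ] ℝ :=
  innerCLM _ + fderiv ℝ (fderiv ℝ Ψ) x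

lemma hasFDerivAt_pot (hΨ : Differentiable ℝ Ψ) (x : EuclideanSpace ℝ ι) :
    HasFDerivAt (fun y => ‖y‖ ^ 2 / 2 + Ψ y) (potDeriv Ψ x) x := by
  refine HasFDerivAt.fun_add ?_ (hΨ x).hasFDerivAt
  have := (hasStrictFDerivAt_norm_sq x).hasFDerivAt.mul_const (2⁻¹ : ℝ)
  simp only [← div_eq_mul_inv] at this
  refine this.congr_fderiv ?_
  ext u
  simp

lemma hasFDerivAt_potDeriv (hΨ' : Differentiable ℝ (fderiv ℝ Ψ)) (x : EuclideanSpace ℝ ι) :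
    HasFDerivAt (potDeriv Ψ) (potDeriv₂ Ψ x) x :=
  (innerCLM _).hasFDerivAt.fun_add (hΨ' x).hasFDerivAt

lemma hess_pot [DecidableEq ι] (hΨ : Differentiable ℝ Ψ)
    (hΨ' : Differentiable ℝ (fderiv ℝ Ψ)) (x : EuclideanSpace ℝ ι) (l l' : ι) :
    hess (fun y => ‖y‖ ^ 2 / 2 + Ψ y) x l l' =
      potDeriv₂ Ψ x (EuclideanSpace.single l 1) (EuclideanSpace.single l' 1) := by
  have h1 : pd (fun y => ‖y‖ ^ 2 / 2 + Ψ y) l' =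
      fun y => potDeriv Ψ y (EuclideanSpace.single l' 1) := by
    funext y
    simp only [pd, (hasFDerivAt_pot hΨ y).fderiv]
  have h3 := (hasFDerivAt_potDeriv hΨ' x).clm_apply
    (hasFDerivAt_const (EuclideanSpace.single l' (1 : ℝ)) x)
  unfold hess
  rw [h1]
  unfold pd
  rw [h3.fderiv]
  simp

/-- The linear map `χ ↦ ∑ l, χ (e_l) • M e_l` turning a derivative into a rescaled gradient. -/
def gradScale [DecidableEq ι] (M : EuclideanSpace ℝ ι →L[ℝ] EuclideanSpace ℝ ι) :
    (EuclideanSpace ℝ ι →L[ℝ] ℝ) →L[ℝ] EuclideanSpace ℝ ι :=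
  ∑ l, (ContinuousLinearMap.apply ℝ ℝ (EuclideanSpace.single l (1 : ℝ))).smulRight
    (M (EuclideanSpace.single l 1))

lemma gradScale_apply [DecidableEq ι] (M : EuclideanSpace ℝ ι →L[ℝ] EuclideanSpace ℝ ι)
    (χ : EuclideanSpace ℝ ι →L[ℝ] ℝ) :
    gradScale M χ = ∑ l, χ (EuclideanSpace.single l 1) • M (EuclideanSpace.single l 1) := by
  simp [gradScale]

lemma gradScale_diagEquiv_apply [DecidableEq ι] (ρ : ι → ℝ) (hρ : ∀ l, ρ l ≠ 0)
    (χ : EuclideanSpace ℝ ι →L[ℝ] ℝ) (l : ι) :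
    gradScale (diagEquiv ρ hρ : EuclideanSpace ℝ ι →L[ℝ] EuclideanSpace ℝ ι) χ l =
      χ (EuclideanSpace.single l 1) * ρ l := by
  rw [gradScale_apply]
  simp

lemma sum_smul_single [DecidableEq ι] (u : EuclideanSpace ℝ ι) :
    u = ∑ l, u l • EuclideanSpace.single l (1 : ℝ) := by
  ext l
  simp [Pi.single_apply]

/-- The quadratic form of the rescaled Hessian. -/
lemma inner_gradScale_potDeriv₂ [DecidableEq ι] (hΨ : Differentiable ℝ Ψ)
    (hΨ' : Differentiable ℝ (fderiv ℝ Ψ)) (ρ : ι → ℝ) (hρ : ∀ l, ρ l ≠ 0)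
    (x u : EuclideanSpace ℝ ι) :
    inner ℝ u (gradScale (diagEquiv ρ hρ : EuclideanSpace ℝ ι →L[ℝ] EuclideanSpace ℝ ι)
      (potDeriv₂ Ψ x ((diagEquiv ρ hρ).symm u))) =
      ∑ l, ∑ l', (ρ l)⁻¹ * hess (fun y => ‖y‖ ^ 2 / 2 + Ψ y) x l l' * ρ l' * u l * u l' := by
  rw [PiLp.inner_apply, Finset.sum_comm]
  refine Finset.sum_congr rfl fun l _ => ?_
  rw [gradScale_diagEquiv_apply, sum_smul_single ((diagEquiv ρ hρ).symm u)]
  simp only [map_sum, map_smul, sum_apply, smul_apply, smul_eq_mul, diagEquiv_symm_apply,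
    Finset.sum_mul, hess_pot hΨ hΨ', RCLike.inner_apply, conj_trivial]
  exact Finset.sum_congr rfl fun l' _ => by ring

lemma isContractiveLangevin_diagEquiv [DecidableEq ι] (hΨ : Differentiable ℝ Ψ)
    (hΨ' : Differentiable ℝ (fderiv ℝ Ψ)) {c₀ c₁ c₂ δ₀ : ℝ} (hc₀ : ∀ x, ‖fderiv ℝ Ψ x‖ ≤ c₀)
    (hc₁ : ∀ x, ‖fderiv ℝ (fderiv ℝ Ψ) x‖ ≤ c₁)
    (hc₂ : ∀ x y, ‖fderiv ℝ (fderiv ℝ Ψ) x - fderiv ℝ (fderiv ℝ Ψ) y‖ ≤ c₂ * ‖x - y‖)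
    (hc₂' : 0 ≤ c₂) (hδ₀ : 0 < δ₀) (hδ₁ : δ₀ ≤ 1) (ρ : ι → ℝ) (hρ : ∀ l, ρ l ≠ 0)
    (hcoer : ∀ x u : EuclideanSpace ℝ ι, δ₀ * ∑ l, u l ^ 2 ≤
      ∑ l, ∑ l', (ρ l)⁻¹ * hess (fun y => ‖y‖ ^ 2 / 2 + Ψ y) x l l' * ρ l' * u l * u l') :
    ∃ K C ε₀, IsContractiveLangevin (Measure.map (diagEquiv ρ hρ) volume)
      (fun l => diagEquiv ρ hρ (EuclideanSpace.single l 1))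
      (fun y => Real.exp (-(‖(diagEquiv ρ hρ).symm y‖ ^ 2 / 2 + Ψ ((diagEquiv ρ hρ).symm y))))
      (fun y => (potDeriv Ψ ((diagEquiv ρ hρ).symm y)).comp
        ((diagEquiv ρ hρ).symm : EuclideanSpace ℝ ι →L[ℝ] EuclideanSpace ℝ ι))
      (fun y => (gradScale (diagEquiv ρ hρ : EuclideanSpace ℝ ι →L[ℝ] EuclideanSpace ℝ ι)).comp
        ((potDeriv₂ Ψ ((diagEquiv ρ hρ).symm y)).comp
          ((diagEquiv ρ hρ).symm : EuclideanSpace ℝ ι →L[ℝ] EuclideanSpace ℝ ι)))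
      K C (δ₀ / 2) ε₀ := by
  have hform := inner_gradScale_potDeriv₂ hΨ hΨ' ρ hρ
  set M := diagEquiv ρ hρ
  set N : EuclideanSpace ℝ ι →L[ℝ] EuclideanSpace ℝ ι :=
    (M.symm : EuclideanSpace ℝ ι →L[ℝ] EuclideanSpace ℝ ι) with hN
  set G := gradScale (M : EuclideanSpace ℝ ι →L[ℝ] EuclideanSpace ℝ ι) with hG
  have hMN : ∀ y, M.symm y = N y := fun y => rfl
  have hbound : ∀ x, ‖potDeriv₂ Ψ x‖ ≤ ‖innerCLM (EuclideanSpace ℝ ι)‖ + c₁ := fun x => by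
    unfold potDeriv₂
    have h := norm_add_le (innerCLM (EuclideanSpace ℝ ι)) (fderiv ℝ (fderiv ℝ Ψ) x)
    linarith [hc₁ x]
  have hc₁' : 0 ≤ c₁ := (norm_nonneg (fderiv ℝ (fderiv ℝ Ψ) 0)).trans (hc₁ 0)
  set B := ‖G‖ * ((‖innerCLM (EuclideanSpace ℝ ι)‖ + c₁) * ‖N‖) with hB
  refine ⟨(‖innerCLM (EuclideanSpace ℝ ι)‖ + c₁) * ‖N‖ * ‖N‖, ‖G‖ * (c₂ * ‖N‖ * ‖N‖),
    min 1 (δ₀ / (B ^ 2 + 1)), fun y => (Real.exp_pos _).le, fun y => ?_, fun p => ?_,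
    fun x y => ?_, fun y => ?_, fun x y => ?_, by positivity, by positivity, by positivity,
    fun ε hε hε' x => ?_⟩
  · have h := ((hasFDerivAt_pot hΨ (N y)).comp y N.hasFDerivAt).fun_neg.exp
    refine h.congr_fderiv ?_
    ext u
    simp [hMN]
  · have hemb : MeasurableEmbedding M := M.toHomeomorph.measurableEmbedding
    rw [hemb.integrable_map_iff]
    have hgrowth : HasPolyGrowth fun x : EuclideanSpace ℝ ι => (1 + ‖M x‖) ^ p := by
      refine HasPolyGrowth.pow (HasPolyGrowth.add (HasPolyGrowth.const 1)
        (HasPolyGrowth.norm_of_lipschitz (L := ‖(M : EuclideanSpace ℝ ι →L[ℝ] EuclideanSpace ℝ ι)‖)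
          fun x y => ?_)) p
      rw [← map_sub]
      exact ContinuousLinearMap.le_opNorm (M : EuclideanSpace ℝ ι →L[ℝ] EuclideanSpace ℝ ι) _
    have hc := hΨ.continuous
    refine (hgrowth.integrable_mul (w := fun x => Real.exp (-(‖x‖ ^ 2 / 2 + Ψ x)))
      (by fun_prop) (fun x => (Real.exp_pos _).le)
      (integrable_one_add_norm_pow_mul_exp_neg hΨ hc₀)).congr (ae_of_all _ fun x => ?_)
    simp
  · have h1 : ‖potDeriv Ψ (N x) - potDeriv Ψ (N y)‖ ≤
        (‖innerCLM (EuclideanSpace ℝ ι)‖ + c₁) * ‖N x - N y‖ :=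
      convex_univ.norm_image_sub_le_of_norm_hasFDerivWithin_le
        (fun z _ => (hasFDerivAt_potDeriv hΨ' z).hasFDerivWithinAt) (fun z _ => hbound z)
        (Set.mem_univ _) (Set.mem_univ _)
    have h2 : ‖N x - N y‖ ≤ ‖N‖ * ‖x - y‖ := by rw [← map_sub]; exact N.le_opNorm _
    simp only [hMN, ← ContinuousLinearMap.sub_comp]
    calc _ ≤ ‖potDeriv Ψ (N x) - potDeriv Ψ (N y)‖ * ‖N‖ := ContinuousLinearMap.opNorm_comp_le _ _
      _ ≤ (‖innerCLM (EuclideanSpace ℝ ι)‖ + c₁) * (‖N‖ * ‖x - y‖) * ‖N‖ := by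
        gcongr; exact h1.trans (by gcongr)
      _ = _ := by ring
  · have h := G.hasFDerivAt.comp y ((hasFDerivAt_potDeriv hΨ' (N y)).comp y N.hasFDerivAt)
    refine h.congr_of_eventuallyEq (Eventually.of_forall fun z => ?_)
    simp [hG, gradScale_apply, hN]
  · have h2 : ‖N x - N y‖ ≤ ‖N‖ * ‖x - y‖ := by rw [← map_sub]; exact N.le_opNorm _
    have h3 : potDeriv₂ Ψ (N x) - potDeriv₂ Ψ (N y) =
        fderiv ℝ (fderiv ℝ Ψ) (N x) - fderiv ℝ (fderiv ℝ Ψ) (N y) := by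
      ext u v
      simp [potDeriv₂]
    simp only [hMN, ← ContinuousLinearMap.comp_sub, ← ContinuousLinearMap.sub_comp]
    calc _ ≤ ‖G‖ * (‖potDeriv₂ Ψ (N x) - potDeriv₂ Ψ (N y)‖ * ‖N‖) :=
          (ContinuousLinearMap.opNorm_comp_le _ _).trans
            (by gcongr; exact ContinuousLinearMap.opNorm_comp_le _ _)
      _ ≤ ‖G‖ * (c₂ * (‖N‖ * ‖x - y‖) * ‖N‖) := by
        rw [h3]; gcongr; exact (hc₂ _ _).trans (by gcongr)
      _ = _ := by ring
  · have hε₁ : ε ≤ 1 := hε'.trans (min_le_left _ _)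
    have hεB : ε * (B ^ 2 + 1) ≤ δ₀ := by
      rw [← le_div_iff₀ (by positivity)]; exact hε'.trans (min_le_right _ _)
    refine norm_id_sub_smul_le (B := B) ?_ hδ₀.le hδ₁ (fun u => ?_) hε hε₁ (by linarith)
    · calc _ ≤ ‖G‖ * (‖potDeriv₂ Ψ (N x)‖ * ‖N‖) :=
          (ContinuousLinearMap.opNorm_comp_le _ _).trans
            (by gcongr; exact ContinuousLinearMap.opNorm_comp_le _ _)
        _ ≤ B := by rw [hB]; gcongr; exact hbound _
    · rw [EuclideanSpace.real_norm_sq_eq]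
      exact (hcoer (N x) u).trans_eq (hform _ u).symm

/-- Weighted covariance bound: if the conjugated Hessian `ρ⁻¹ (Hess Φ) ρ` is at least `δ₀`, then
`|cov (x_i, x_j)| ≤ (2 / δ₀) ρ_j / ρ_i`. -/
lemma abs_cov_gibbs_le [DecidableEq ι] (hΨ : Differentiable ℝ Ψ)
    (hΨ' : Differentiable ℝ (fderiv ℝ Ψ)) {c₀ c₁ c₂ δ₀ : ℝ} (hc₀ : ∀ x, ‖fderiv ℝ Ψ x‖ ≤ c₀)
    (hc₁ : ∀ x, ‖fderiv ℝ (fderiv ℝ Ψ) x‖ ≤ c₁)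
    (hc₂ : ∀ x y, ‖fderiv ℝ (fderiv ℝ Ψ) x - fderiv ℝ (fderiv ℝ Ψ) y‖ ≤ c₂ * ‖x - y‖)
    (hc₂' : 0 ≤ c₂) (hδ₀ : 0 < δ₀) (hδ₁ : δ₀ ≤ 1) (ρ : ι → ℝ) (hρ : ∀ l, 0 < ρ l)
    (hcoer : ∀ x u : EuclideanSpace ℝ ι, δ₀ * ∑ l, u l ^ 2 ≤
      ∑ l, ∑ l', (ρ l)⁻¹ * hess (fun y => ‖y‖ ^ 2 / 2 + Ψ y) x l l' * ρ l' * u l * u l')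
    (i j : ι) :
    |(∫ x, x i * x j ∂(gibbs (fun y => ‖y‖ ^ 2 / 2 + Ψ y))) -
        (∫ x, x i ∂(gibbs (fun y => ‖y‖ ^ 2 / 2 + Ψ y))) *
          (∫ x, x j ∂(gibbs (fun y => ‖y‖ ^ 2 / 2 + Ψ y)))| ≤ 2 / δ₀ * (ρ j / ρ i) := by
  have hρ' : ∀ l, ρ l ≠ 0 := fun l => (hρ l).ne'
  obtain ⟨K, C, ε₀, H⟩ :=
    isContractiveLangevin_diagEquiv hΨ hΨ' hc₀ hc₁ hc₂ hc₂' hδ₀ hδ₁ ρ hρ' hcoer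
  have hc := hΨ.continuous
  have hcont : Continuous fun y : EuclideanSpace ℝ ι => ‖y‖ ^ 2 / 2 + Ψ y := by fun_prop
  simp only [integral_gibbs hcont]
  set M := diagEquiv ρ hρ' with hM
  set w : EuclideanSpace ℝ ι → ℝ := fun x => Real.exp (-(‖x‖ ^ 2 / 2 + Ψ x)) with hw
  have hmom : ∀ p, Integrable fun x => (1 + ‖x‖) ^ p * w x :=
    integrable_one_add_norm_pow_mul_exp_neg hΨ hc₀
  have hwc : Continuous w := by fun_prop
  have hw0 : ∀ x, 0 ≤ w x := fun x => (Real.exp_pos _).le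
  have hwint : Integrable w := by simpa using hmom 0
  have hemb : MeasurableEmbedding M := M.toHomeomorph.measurableEmbedding
  have hZ : 0 < ∫ x, w x := integral_exp_pos hwint
  have hcoord : ∀ l, HasPolyGrowth fun x : EuclideanSpace ℝ ι => x l := fun l =>
    HasPolyGrowth.mono (by fun_prop) HasPolyGrowth.norm fun x => PiLp.norm_apply_le x l
  have hintl : ∀ l, Integrable fun x => x l * w x := fun l =>
    (hcoord l).integrable_mul hwc hw0 hmom
  have hintij : Integrable fun x => x i * x j * w x :=
    ((hcoord i).mul (hcoord j)).integrable_mul hwc hw0 hmom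
  set Z := ∫ x, w x with hZdef
  set m := Z⁻¹ * ∫ x, x j * w x with hm
  let φ : ι → EuclideanSpace ℝ ι →L[ℝ] ℝ := fun l =>
    (EuclideanSpace.proj l : EuclideanSpace ℝ ι →L[ℝ] ℝ).comp
      (M.symm : EuclideanSpace ℝ ι →L[ℝ] EuclideanSpace ℝ ι)
  have hφ : ∀ l x, φ l (M x) = x l := fun l x => by simp [φ]
  have hφM : ∀ l y, φ l y = (M.symm y) l := fun l y => rfl
  have : (Measure.map M (volume : Measure (EuclideanSpace ℝ ι))).IsAddHaarMeasure :=
    M.isAddHaarMeasure_map volume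
  have hcov : ∫ x, (x j - m) * w x = 0 := by
    simp only [sub_mul]
    rw [integral_sub (hintl j) (hwint.const_mul m), integral_const_mul, ← hZdef, hm]
    field_simp
    simp
  have key := H.abs_integral_clm_mul_le (φ i) (φ j) m (by
    rw [hemb.integral_map]
    simpa only [hφ, ContinuousLinearEquiv.symm_apply_apply] using hcov)
  rw [hemb.integral_map, hemb.integral_map] at key
  simp only [hφ, ContinuousLinearEquiv.symm_apply_apply] at key
  have hsum : ∑ l, (EuclideanSpace.single l (1 : ℝ) : EuclideanSpace ℝ ι) j •
      M (EuclideanSpace.single l 1) = M (EuclideanSpace.single j 1) := by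
    rw [Finset.sum_eq_single j] <;> simp +contextual [eq_comm]
  have hnorm : ‖M (EuclideanSpace.single j 1)‖ = ρ j := by
    have : M (EuclideanSpace.single j 1) = EuclideanSpace.single j (ρ j) := by
      ext l
      rcases eq_or_ne l j with rfl | h <;> simp [*]
    rw [this, PiLp.norm_single, Real.norm_of_nonneg (hρ j).le]
  have hφnorm : ‖φ i‖ ≤ (ρ i)⁻¹ := by
    refine ContinuousLinearMap.opNorm_le_bound _ (inv_nonneg.2 (hρ i).le) fun y => ?_
    rw [hφM, diagEquiv_symm_apply, norm_mul, Real.norm_of_nonneg (inv_nonneg.2 (hρ i).le)]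
    exact mul_le_mul_of_nonneg_left (PiLp.norm_apply_le y i) (inv_nonneg.2 (hρ i).le)
  rw [hsum, hnorm] at key
  have hrepr : Z⁻¹ * (∫ x, x i * x j * w x) - Z⁻¹ * (∫ x, x i * w x) * m =
      Z⁻¹ * ∫ x, x i * (x j - m) * w x := by
    have : (fun x : EuclideanSpace ℝ ι => x i * (x j - m) * w x) =
        fun x => x i * x j * w x - m * (x i * w x) := by
      funext x; ring
    rw [this, integral_sub hintij ((hintl i).const_mul m), integral_const_mul]
    ring
  rw [hrepr, abs_mul, abs_of_pos (inv_pos.2 hZ)]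
  calc _ ≤ Z⁻¹ * (ρ j * Z / (δ₀ / 2) * (ρ i)⁻¹) := by
        gcongr
        exact key.trans (by have := (hρ j).le; gcongr)
    _ = _ := by field_simp

end Gibbs

lemma latDist_comm {d : ℕ} (i j : Fin d → ℤ) : latDist i j = latDist j i :=
  Finset.sum_congr rfl fun k _ => by omega

lemma latDist_triangle {d : ℕ} (i j k : Fin d → ℤ) : latDist i k ≤ latDist i j + latDist j k := by
  unfold latDist
  rw [← Finset.sum_add_distrib]
  exact Finset.sum_le_sum fun l _ => by omega

lemma norm_fderiv_sub_le_of_norm_iteratedFDeriv_two_le {E V : Type*} [NormedAddCommGroup E]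
    [NormedSpace ℝ E] [NormedAddCommGroup V] [NormedSpace ℝ V] {f : E → V}
    (hf : ContDiff ℝ 2 f) {c : ℝ} (hc : ∀ x, ‖iteratedFDeriv ℝ 2 f x‖ ≤ c) (x y : E) :
    ‖fderiv ℝ f x - fderiv ℝ f y‖ ≤ c * ‖x - y‖ := by
  have hf' : ContDiff ℝ 1 (fderiv ℝ f) := hf.fderiv_right (by norm_num)
  refine convex_univ.norm_image_sub_le_of_norm_fderiv_le
    (fun z _ => hf'.differentiable (by simp) z) (fun z _ => ?_) (Set.mem_univ y) (Set.mem_univ x)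
  rw [← norm_iteratedFDeriv_one, norm_iteratedFDeriv_fderiv]
  exact hc z

/-- Under the hypotheses of the weighted gradient estimate
(`Φ = x²/2 + Ψ`, `|∂^α∇Ψ| ≤ C_α`, conjugated-Hessian bound `≥ δ₀ ∈ (0,1)` for all
admissible exponential weights), the two-point correlation function satisfies
`|cor(i,j)| = |cov(x_i,x_j)| ≤ C e^{−κ d(i,j)}` for distinct sites `i, j ∈ Λ`, with
`C, κ > 0` independent of `Λ`. -/
theorem exponential_decay_two_point_correlation
    (d : ℕ) (lam δ₀ : ℝ) (hlam : 0 < lam) (hδ₀ : 0 < δ₀) (hδ₀1 : δ₀ < 1)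
    (Cψ : ℕ → ℝ) :
    ∃ C κ : ℝ, 0 < C ∧ 0 < κ ∧
      ∀ (Λ : Finset (Fin d → ℤ)) (i j : ↥Λ), (↑i : Fin d → ℤ) ≠ ↑j →
      ∀ Ψ : EuclideanSpace ℝ ↥Λ → ℝ,
        ContDiff ℝ (⊤ : ℕ∞) Ψ →
        (∀ (n : ℕ) x, ‖iteratedFDeriv ℝ (n + 1) Ψ x‖ ≤ Cψ n) →
        (∀ ρ : (Fin d → ℤ) → ℝ, (∀ l, 0 < ρ l) →
          (∀ l l' : Fin d → ℤ, latDist l l' = 1 →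
            Real.exp (-lam) ≤ ρ l / ρ l' ∧ ρ l / ρ l' ≤ Real.exp lam) →
          ∀ (x : EuclideanSpace ℝ ↥Λ) (a : ↥Λ → ℝ),
            δ₀ * ∑ l, (a l) ^ 2 ≤
              ∑ l : ↥Λ, ∑ l' : ↥Λ, (ρ (↑l : Fin d → ℤ))⁻¹ *
                hess (fun y => ‖y‖ ^ 2 / 2 + Ψ y) x l l' *
                ρ (↑l' : Fin d → ℤ) * a l * a l') →
        |(∫ x, x i * x j ∂(gibbs (fun y => ‖y‖ ^ 2 / 2 + Ψ y))) -
            (∫ x, x i ∂(gibbs (fun y => ‖y‖ ^ 2 / 2 + Ψ y))) *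
              (∫ x, x j ∂(gibbs (fun y => ‖y‖ ^ 2 / 2 + Ψ y)))| ≤
          C * Real.exp (-κ * (latDist (↑i : Fin d → ℤ) ↑j : ℝ)) := by
  refine ⟨2 / δ₀, lam, by positivity, hlam, fun Λ i j _ Ψ hΨ hbd hcoer => ?_⟩
  have hΨ₁ : ContDiff ℝ (⊤ : ℕ∞) (fderiv ℝ Ψ) := hΨ.fderiv_right (by simp)
  have hρ : ∀ l l' : Fin d → ℤ, latDist l l' = 1 →
      Real.exp (-lam * latDist l i) / Real.exp (-lam * latDist l' i) ≤ Real.exp lam := by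
    intro l l' h
    rw [← Real.exp_sub, Real.exp_le_exp]
    have h1 : (latDist l' i : ℝ) ≤ 1 + latDist l i := by
      rw [latDist_comm] at h
      exact_mod_cast (latDist_triangle l' l i).trans_eq (by rw [h])
    nlinarith
  have key := abs_cov_gibbs_le (hΨ.differentiable (by simp)) (hΨ₁.differentiable (by simp))
    (fun x => by rw [← norm_iteratedFDeriv_one]; exact hbd 0 x)
    (fun x => by
      rw [← norm_iteratedFDeriv_one, norm_iteratedFDeriv_fderiv]
      exact hbd 1 x)
    (norm_fderiv_sub_le_of_norm_iteratedFDeriv_two_le (contDiff_infty.1 hΨ₁ 2)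
      fun x => by rw [norm_iteratedFDeriv_fderiv]; exact hbd 2 x)
    ((norm_nonneg _).trans (hbd 2 0)) hδ₀ hδ₀1.le
    (fun l : ↥Λ => Real.exp (-lam * latDist (l : Fin d → ℤ) i)) (fun l => Real.exp_pos _)
    (fun x u => hcoer (fun l => Real.exp (-lam * latDist l i)) (fun l => Real.exp_pos _)
      (fun l l' h => ⟨?_, hρ l l' h⟩) x u) i j
  · have hself : latDist (i : Fin d → ℤ) i = 0 := by simp [latDist]
    simpa [hself, latDist_comm (j : Fin d → ℤ) i] using key
  · rw [Real.exp_neg, inv_le_comm₀ (Real.exp_pos _) (by positivity), inv_div]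
    exact hρ l' l (by rwa [latDist_comm])
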